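/- arXiv:1105.4562 — 6 statements merged into one kernel-verified Lean document; each statement's English description precedes it below -/
import Mathlib

section
/- There is an absolute constant C > 0 such that for all t > 0 and all x, y ∈ ℝ, the Hermite heat kernel W_t^H(x,y) is differentiable in t and |∂W_t^H(x,y)/∂t| ≤ C · e^{-t/2} · (1-e^{-2t})^{-3/2} · exp(-((x - e^{-t}y)² + (y - e^{-t}x)²)/(8(1-e^{-2t}))). -/
open MeasureTheory Set

/-- The Hermite heat kernel `W_t^H(x,y)`. -/
noncomputable def WH (t x y : ℝ) : ℝ :=
  (1 / Real.sqrt Real.pi) * Real.sqrt (Real.exp (-t) / (1 - Real.exp (-2*t))) *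
    Real.exp (-(((x - Real.exp (-t) * y)^2 + (y - Real.exp (-t) * x)^2) /
      (2 * (1 - Real.exp (-2*t)))))

theorem exp_neg_two_mul_eq_sq (t : ℝ) : Real.exp (-2 * t) = Real.exp (-t) ^ 2 := by
  rw [← Real.exp_nat_mul]
  congr 1
  push_cast
  ring

theorem one_sub_exp_neg_two_mul_pos {t : ℝ} (ht : 0 < t) : 0 < 1 - Real.exp (-2 * t) := by
  have h : Real.exp (-2 * t) < 1 := Real.exp_lt_one_iff.2 (by linarith)
  linarith

theorem HasDerivAt.sqrt_of_mul {q : ℝ → ℝ} {a t : ℝ} (hq : HasDerivAt q (q t * a) t)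
    (hpos : 0 < q t) :
    HasDerivAt (fun s => Real.sqrt (q s)) (Real.sqrt (q t) * (a / 2)) t := by
  refine (hq.sqrt hpos.ne').congr_deriv ?_
  have h : Real.sqrt (q t) ≠ 0 := (Real.sqrt_pos.2 hpos).ne'
  field_simp
  rw [Real.sq_sqrt hpos.le, mul_comm]

/-- The logarithmic derivative in `t` of the Hermite heat kernel. -/
theorem hasDerivAt_WH {t : ℝ} (ht : 0 < t) (x y : ℝ) :
    HasDerivAt (fun s => WH s x y)
      (WH t x y * (-(1 / 2) - Real.exp (-t) ^ 2 / (1 - Real.exp (-2 * t)) -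
        2 * Real.exp (-t) * ((x - Real.exp (-t) * y) * (y - Real.exp (-t) * x)) /
          (1 - Real.exp (-2 * t)) ^ 2)) t := by
  have hd := one_sub_exp_neg_two_mul_pos ht
  have hr : HasDerivAt (fun s : ℝ => Real.exp (-s)) (-Real.exp (-t)) t := by
    simpa using (hasDerivAt_neg t).exp
  have hD : HasDerivAt (fun s : ℝ => 1 - Real.exp (-2 * s)) (2 * Real.exp (-t) ^ 2) t := by
    refine (((hasDerivAt_id' t).const_mul (-2)).exp.const_sub 1).congr_deriv ?_
    rw [exp_neg_two_mul_eq_sq]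
    ring
  have hq : HasDerivAt (fun s : ℝ => Real.exp (-s) / (1 - Real.exp (-2 * s)))
      (Real.exp (-t) / (1 - Real.exp (-2 * t)) *
        (-1 - 2 * Real.exp (-t) ^ 2 / (1 - Real.exp (-2 * t)))) t := by
    refine (hr.fun_div hD hd.ne').congr_deriv ?_
    generalize 1 - Real.exp (-2 * t) = d at hd ⊢
    field_simp
  have hS := (((hr.mul_const y).const_sub x).fun_pow 2).fun_add
    (((hr.mul_const x).const_sub y).fun_pow 2)
  have hE := (hS.fun_div (hD.const_mul 2) (by positivity)).fun_neg.exp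
  have hW := ((hq.sqrt_of_mul (by positivity)).const_mul (1 / Real.sqrt Real.pi)).fun_mul hE
  refine hW.congr_deriv ?_
  unfold WH
  generalize Real.exp (-(((x - Real.exp (-t) * y)^2 + (y - Real.exp (-t) * x)^2) /
      (2 * (1 - Real.exp (-2*t))))) = E
  generalize Real.sqrt (Real.exp (-t) / (1 - Real.exp (-2*t))) = Q
  rw [exp_neg_two_mul_eq_sq] at hd ⊢
  generalize Real.exp (-t) = r at hd ⊢
  field_simp
  ring

theorem sqrt_exp_neg_div {t d : ℝ} (hd : 0 < d) :
    Real.sqrt (Real.exp (-t) / d) / d = Real.exp (-t / 2) * d ^ (-(3 : ℝ) / 2) := by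
  have h : d ^ (-(3 : ℝ) / 2) = (Real.sqrt d)⁻¹ * d⁻¹ := by
    rw [Real.sqrt_eq_rpow, ← Real.rpow_neg hd.le, ← Real.rpow_neg_one, ← Real.rpow_add hd]
    norm_num
  rw [h, Real.sqrt_div (Real.exp_pos _).le, Real.exp_half]
  field_simp

theorem one_add_mul_exp_le {u : ℝ} (hu : 0 ≤ u) :
    (1 + u) * Real.exp (-(u / 2)) ≤ 4 * Real.exp (-(u / 8)) := by
  have h : 1 + u ≤ 4 * Real.exp (3 * u / 8) := by
    linarith [Real.add_one_le_exp (3 * u / 8)]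
  calc (1 + u) * Real.exp (-(u / 2)) ≤ 4 * Real.exp (3 * u / 8) * Real.exp (-(u / 2)) := by gcongr
    _ = 4 * Real.exp (-(u / 8)) := by
      rw [mul_assoc, ← Real.exp_add]
      ring_nf

theorem abs_log_deriv_le {r d A B : ℝ} (hr : 0 ≤ r) (hr1 : r ≤ 1) (hd : 0 < d)
    (hrd : d = 1 - r ^ 2) :
    |-(1 / 2) - r ^ 2 / d - 2 * r * (A * B) / d ^ 2| ≤ (1 + (A ^ 2 + B ^ 2) / d) / d := by
  have hAB : |2 * r * (A * B)| ≤ A ^ 2 + B ^ 2 := by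
    have h1 : |2 * (A * B)| ≤ A ^ 2 + B ^ 2 :=
      abs_le.2 ⟨by nlinarith [sq_nonneg (A + B)], by nlinarith [sq_nonneg (A - B)]⟩
    calc |2 * r * (A * B)| = r * |2 * (A * B)| := by
          rw [show 2 * r * (A * B) = r * (2 * (A * B)) by ring, abs_mul, abs_of_nonneg hr]
      _ ≤ 1 * |2 * (A * B)| := by gcongr
      _ ≤ A ^ 2 + B ^ 2 := by linarith
  rw [show -(1 / 2) - r ^ 2 / d - 2 * r * (A * B) / d ^ 2 =
      -((d / 2 + r ^ 2) * d + 2 * r * (A * B)) / d ^ 2 by field_simp; ring,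
    show (1 + (A ^ 2 + B ^ 2) / d) / d = (d + (A ^ 2 + B ^ 2)) / d ^ 2 by field_simp,
    abs_div, abs_neg, abs_of_pos (pow_pos hd 2)]
  gcongr
  refine (abs_add_le _ _).trans (add_le_add ?_ hAB)
  rw [abs_of_nonneg (by positivity)]
  nlinarith

theorem hermite_kernel_time_derivative_bound :
    ∃ C > (0:ℝ), ∀ t > (0:ℝ), ∀ x y : ℝ,
      DifferentiableAt ℝ (fun s => WH s x y) t ∧
      |deriv (fun s => WH s x y) t| ≤
        C * Real.exp (-t/2) * (1 - Real.exp (-2*t)) ^ (-(3:ℝ)/2) *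
          Real.exp (-(((x - Real.exp (-t) * y)^2 + (y - Real.exp (-t) * x)^2) /
            (8 * (1 - Real.exp (-2*t))))) := by
  refine ⟨4, by norm_num, fun t ht x y => ?_⟩
  have hW := hasDerivAt_WH ht x y
  refine ⟨hW.differentiableAt, ?_⟩
  have hd := one_sub_exp_neg_two_mul_pos ht
  have hlog := abs_log_deriv_le (A := x - Real.exp (-t) * y) (B := y - Real.exp (-t) * x)
    (Real.exp_pos (-t)).le (Real.exp_le_one_iff.2 (by linarith)) hd
    (by rw [exp_neg_two_mul_eq_sq])
  have hpi : 1 / Real.sqrt Real.pi ≤ 1 := by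
    rw [div_le_one (by positivity), Real.one_le_sqrt]
    linarith [Real.pi_gt_three]
  rw [hW.deriv, abs_mul, mul_assoc 4, ← sqrt_exp_neg_div hd]
  unfold WH
  rw [abs_of_nonneg (by positivity)]
  set d := 1 - Real.exp (-2 * t)
  set S := (x - Real.exp (-t) * y) ^ 2 + (y - Real.exp (-t) * x) ^ 2
  have hS : 0 ≤ S := by positivity
  rw [show S / (2 * d) = S / d / 2 by field_simp, show S / (8 * d) = S / d / 8 by field_simp]
  set Q := Real.sqrt (Real.exp (-t) / d)
  have hQ : 0 ≤ Q := Real.sqrt_nonneg _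
  calc _ ≤ 1 * Q * Real.exp (-(S / d / 2)) * ((1 + S / d) / d) := by gcongr
    _ = Q / d * ((1 + S / d) * Real.exp (-(S / d / 2))) := by ring
    _ ≤ Q / d * (4 * Real.exp (-(S / d / 8))) := by
      exact mul_le_mul_of_nonneg_left (one_add_mul_exp_le (by positivity)) (by positivity)
    _ = _ := by ring
end

section
/- There is a constant C > 0 such that for all x, y ∈ ℝ with x ≠ y, ∫_0^1 exp(-(x-y)²/(16s) - s(x+y)²/16) · s^{-3/2} (1-s)^{-1/2} ds ≤ C/|x-y|. -/
open MeasureTheory Set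

theorem hasDerivAt_inv_one_add_sq (v : ℝ) :
    HasDerivAt (fun v : ℝ => (1 + v ^ 2)⁻¹) (-(2 * v) / (1 + v ^ 2) ^ 2) v := by
  have h : HasDerivAt (fun v : ℝ => 1 + v ^ 2) (2 * v) v := by
    simpa using (hasDerivAt_pow 2 v).const_add 1
  exact h.fun_inv (by positivity)

theorem injOn_inv_one_add_sq : InjOn (fun v : ℝ => (1 + v ^ 2)⁻¹) (Ioi 0) := by
  intro v hv w hw h
  have h' : v ^ 2 = w ^ 2 := add_left_cancel (inv_injective h)
  exact (pow_left_inj₀ (le_of_lt hv) (le_of_lt hw) two_ne_zero).1 h'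

theorem image_inv_one_add_sq_Ioi :
    (fun v : ℝ => (1 + v ^ 2)⁻¹) '' Ioi 0 = Ioo 0 1 := by
  ext s
  constructor
  · rintro ⟨v, hv, rfl⟩
    have hv : 0 < v := hv
    exact ⟨by positivity, inv_lt_one_of_one_lt₀ (by nlinarith [sq_pos_of_pos hv])⟩
  · rintro ⟨h0, h1⟩
    have h : 0 < s⁻¹ - 1 := sub_pos.2 ((one_lt_inv₀ h0).2 h1)
    refine ⟨√(s⁻¹ - 1), Real.sqrt_pos.2 h, ?_⟩
    simp [Real.sq_sqrt h.le]

theorem abs_deriv_mul_rpow_inv_one_add_sq {v : ℝ} (hv : 0 < v) :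
    |-(2 * v) / (1 + v ^ 2) ^ 2| * (((1 + v ^ 2)⁻¹) ^ (-(3:ℝ)/2) *
      (1 - (1 + v ^ 2)⁻¹) ^ (-(1:ℝ)/2)) = 2 := by
  have hw : (0:ℝ) < 1 + v ^ 2 := by positivity
  have h1 : 1 - (1 + v ^ 2)⁻¹ = v ^ 2 * (1 + v ^ 2)⁻¹ := by field_simp; ring
  have h2 : (v ^ 2) ^ (-(1:ℝ)/2) = v⁻¹ := by
    rw [← Real.rpow_natCast, ← Real.rpow_mul hv.le, ← Real.rpow_neg_one]
    norm_num
  have h3 : ((1 + v ^ 2)⁻¹) ^ (-(3:ℝ)/2) * ((1 + v ^ 2)⁻¹) ^ (-(1:ℝ)/2) = (1 + v ^ 2) ^ 2 := by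
    rw [← Real.rpow_add (inv_pos.2 hw), Real.inv_rpow hw.le, ← Real.rpow_neg hw.le,
      ← Real.rpow_natCast]
    norm_num
  rw [h1, Real.mul_rpow (by positivity) (by positivity), h2, mul_left_comm _ v⁻¹, h3, abs_div,
    abs_neg, abs_of_pos (by positivity : 0 < 2 * v), abs_of_pos (by positivity)]
  field_simp

theorem hermite_kernel_integral_bound :
    ∃ C > (0:ℝ), ∀ x y : ℝ, x ≠ y →
      (∫ s in Set.Ioo (0:ℝ) 1,
        Real.exp (-((x-y)^2 / (16*s)) - s*(x+y)^2/16) *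
          s ^ (-(3:ℝ)/2) * (1-s) ^ (-(1:ℝ)/2)) ≤ C / |x - y| := by
  refine ⟨4 * √Real.pi, by positivity, fun x y hxy => ?_⟩
  have hd : 0 < |x - y| := abs_pos.2 (sub_ne_zero.2 hxy)
  have hb : 0 < (x - y) ^ 2 / 16 := by rw [← sq_abs]; positivity
  rw [← image_inv_one_add_sq_Ioi, integral_image_eq_integral_abs_deriv_smul measurableSet_Ioi
    (fun v _ => (hasDerivAt_inv_one_add_sq v).hasDerivWithinAt) injOn_inv_one_add_sq]
  calc
    _ ≤ ∫ v in Ioi (0:ℝ), 2 * Real.exp (-((x - y) ^ 2 / 16) * v ^ 2) := by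
      have hint : Integrable (fun v : ℝ => 2 * Real.exp (-((x - y) ^ 2 / 16) * v ^ 2))
          (volume.restrict (Ioi 0)) :=
        ((integrable_exp_neg_mul_sq hb).const_mul 2).integrableOn
      refine integral_mono_of_nonneg ?_ hint ?_
      · filter_upwards [ae_restrict_mem measurableSet_Ioi] with v hv
        have h1 : 0 ≤ 1 - (1 + v ^ 2)⁻¹ :=
          sub_nonneg.2 (inv_le_one_of_one_le₀ (by nlinarith [sq_nonneg v]))
        simp only [Pi.zero_apply, smul_eq_mul]
        positivity
      · filter_upwards [ae_restrict_mem measurableSet_Ioi] with v hv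
        rw [smul_eq_mul, mul_assoc (Real.exp _), mul_left_comm,
          abs_deriv_mul_rpow_inv_one_add_sq hv, mul_comm]
        have h2 : (x - y) ^ 2 / (16 * (1 + v ^ 2)⁻¹) = (x - y) ^ 2 / 16 * (1 + v ^ 2) := by
          field_simp
        have h3 : 0 ≤ (1 + v ^ 2)⁻¹ * (x + y) ^ 2 / 16 := by positivity
        gcongr
        rw [h2]
        linarith
    _ = 4 * √Real.pi / |x - y| := by
      have h16 : √(16:ℝ) = 4 := by
        rw [show (16:ℝ) = 4 ^ 2 by norm_num, Real.sqrt_sq (by norm_num)]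
      rw [integral_const_mul, integral_gaussian_Ioi, Real.sqrt_div Real.pi_pos.le,
        Real.sqrt_div (sq_nonneg _), Real.sqrt_sq_eq_abs, h16]
      field_simp
end

section
/- There is a constant C > 0 such that for every measurable function φ : (0,∞) → ℂ, every A > 0 with |φ(t)| ≤ A for almost every t > 0, and all x, y ∈ ℝ with x ≠ y: the function u ↦ K_φ^H(u,y) is differentiable at x with |∂K_φ^H(x,y)/∂x| ≤ C · A/(x-y)², and the function v ↦ K_φ^H(x,v) is differentiable at y with |∂K_φ^H(x,y)/∂y| ≤ C · A/(x-y)². -/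
open MeasureTheory Set

/-- The kernel `K_φ^H(x,y) = ∫_0^∞ φ(t) (-∂_t W_t^H(x,y)) dt`. -/
noncomputable def KH (φ : ℝ → ℂ) (x y : ℝ) : ℂ :=
  ∫ t in Set.Ioi (0:ℝ), φ t * ((-(deriv (fun s => WH s x y) t) : ℝ) : ℂ)

open Filter Topology

/-- The hyperbolic tangent of `t / 2`. -/
noncomputable def tanhHalf (t : ℝ) : ℝ := (1 - Real.exp (-t)) / (1 + Real.exp (-t))

/-- The exponent of the Mehler kernel in the variable `τ = tanh (t / 2)`. -/
noncomputable def mehlerExponent (τ x y : ℝ) : ℝ := ((x - y) ^ 2 / τ + τ * (x + y) ^ 2) / 4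

/-- The non-exponential factor of the time derivative of the Mehler kernel. -/
noncomputable def mehlerTimeFactor (τ x y : ℝ) : ℝ :=
  -(1 / τ + τ) / 2 - (1 - τ ^ 2) * ((x + y) ^ 2 - (x - y) ^ 2 / τ ^ 2) / 4

/-- The non-exponential factor of the mixed derivative of the Mehler kernel. -/
noncomputable def mehlerMixedFactor (τ x y : ℝ) : ℝ :=
  -(1 - τ ^ 2) * ((x + y) - (x - y) / τ ^ 2) / 2
    - mehlerTimeFactor τ x y * (((x - y) / τ + τ * (x + y)) / 2)

lemma tanhHalf_pos {t : ℝ} (ht : 0 < t) : 0 < tanhHalf t := by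
  have h : Real.exp (-t) < 1 := Real.exp_zero ▸ Real.exp_lt_exp.2 (by linarith)
  have h' := Real.exp_pos (-t)
  unfold tanhHalf
  apply div_pos <;> linarith

lemma tanhHalf_lt_one (t : ℝ) : tanhHalf t < 1 := by
  have h' := Real.exp_pos (-t)
  unfold tanhHalf
  rw [div_lt_one (by linarith)]
  linarith

lemma measurable_tanhHalf : Measurable tanhHalf := by
  unfold tanhHalf
  fun_prop

lemma hasDerivAt_tanhHalf (t : ℝ) : HasDerivAt tanhHalf ((1 - tanhHalf t ^ 2) / 2) t := by
  have h' := Real.exp_pos (-t)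
  have h1 : HasDerivAt (fun s : ℝ => Real.exp (-s)) (-Real.exp (-t)) t := by
    simpa using (hasDerivAt_neg t).exp
  have h2 := (h1.const_sub 1).div (h1.const_add 1) (by positivity)
  refine h2.congr_deriv ?_
  unfold tanhHalf
  field_simp
  ring

lemma sqrt_one_sub_tanhHalf_sq_le (t : ℝ) :
    √(1 - tanhHalf t ^ 2) ≤ 2 * Real.exp (-(t / 2)) := by
  have h' := Real.exp_pos (-(t / 2))
  have h2 : Real.exp (-t) = Real.exp (-(t / 2)) ^ 2 := by
    rw [← Real.exp_nat_mul]; congr 1; push_cast; ring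
  rw [Real.sqrt_le_left (by positivity)]
  unfold tanhHalf
  rw [h2]
  generalize Real.exp (-(t / 2)) = ρ at *
  have : 1 - ((1 - ρ ^ 2) / (1 + ρ ^ 2)) ^ 2 = (2 * ρ) ^ 2 / (1 + ρ ^ 2) ^ 2 := by
    field_simp
    ring
  rw [this]
  apply div_le_self (by positivity)
  nlinarith [sq_nonneg ρ]

lemma half_one_sub_exp_le_tanhHalf {t : ℝ} (ht : 0 < t) :
    (1 - Real.exp (-(t / 2))) / 2 ≤ tanhHalf t := by
  have h' := Real.exp_pos (-(t / 2))
  have h1 : Real.exp (-(t / 2)) < 1 := Real.exp_zero ▸ Real.exp_lt_exp.2 (by linarith)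
  have h2 : Real.exp (-t) = Real.exp (-(t / 2)) ^ 2 := by
    rw [← Real.exp_nat_mul]; congr 1; push_cast; ring
  unfold tanhHalf
  rw [h2]
  generalize Real.exp (-(t / 2)) = ρ at *
  rw [div_le_div_iff₀ (by norm_num) (by positivity)]
  nlinarith [mul_pos h' (sub_pos.2 h1), mul_pos (mul_pos h' (sub_pos.2 h1)) (sub_pos.2 h1)]

lemma WH_comm (t x y : ℝ) : WH t x y = WH t y x := by
  unfold WH
  rw [add_comm]

lemma KH_comm (φ : ℝ → ℂ) (x y : ℝ) : KH φ x y = KH φ y x := by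
  unfold KH
  simp_rw [WH_comm _ x y]

/-- Mehler's formula in the variable `tanh (t / 2)`. -/
lemma WH_eq_tanhHalf {t : ℝ} (ht : 0 < t) (x y : ℝ) :
    WH t x y = 1 / (2 * √Real.pi) *
      (√(1 / tanhHalf t - tanhHalf t) * Real.exp (-mehlerExponent (tanhHalf t) x y)) := by
  have h : Real.exp (-t) < 1 := Real.exp_zero ▸ Real.exp_lt_exp.2 (by linarith)
  have h' := Real.exp_pos (-t)
  have h2 : Real.exp (-2 * t) = Real.exp (-t) ^ 2 := by
    rw [← Real.exp_nat_mul]; congr 1; push_cast; ring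
  unfold WH mehlerExponent tanhHalf
  rw [h2]
  generalize Real.exp (-t) = r at *
  have e0 : 1 - r ≠ 0 := by linarith
  have e1 : 1 - r ^ 2 ≠ 0 := by nlinarith
  have e2 : (1 : ℝ) + r ≠ 0 := by positivity
  have e3 : 1 / ((1 - r) / (1 + r)) - (1 - r) / (1 + r) = 2 ^ 2 * (r / (1 - r ^ 2)) := by
    field_simp
    ring
  have e4 : ((x - r * y) ^ 2 + (y - r * x) ^ 2) / (2 * (1 - r ^ 2)) =
      ((x - y) ^ 2 / ((1 - r) / (1 + r)) + (1 - r) / (1 + r) * (x + y) ^ 2) / 4 := by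
    have : 1 - r ^ 2 = (1 - r) * (1 + r) := by ring
    rw [this]
    field_simp
    ring
  rw [e3, e4, Real.sqrt_mul (by positivity), Real.sqrt_sq (by norm_num)]
  ring

lemma hasDerivAt_WH_time {t : ℝ} (ht : 0 < t) (x y : ℝ) :
    HasDerivAt (fun s => WH s x y) (1 / (4 * √Real.pi) * √(1 / tanhHalf t - tanhHalf t) *
      (mehlerTimeFactor (tanhHalf t) x y * Real.exp (-mehlerExponent (tanhHalf t) x y))) t := by
  have hev : (fun s => WH s x y) =ᶠ[𝓝 t] fun s => 1 / (2 * √Real.pi) *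
      (√(1 / tanhHalf s - tanhHalf s) * Real.exp (-mehlerExponent (tanhHalf s) x y)) := by
    filter_upwards [Ioi_mem_nhds ht] with s hs using WH_eq_tanhHalf hs x y
  refine HasDerivAt.congr_of_eventuallyEq ?_ hev
  have hT := hasDerivAt_tanhHalf t
  have hpos := tanhHalf_pos ht
  have hlt := tanhHalf_lt_one t
  have hg : 0 < 1 / tanhHalf t - tanhHalf t := by
    rw [sub_pos, lt_div_iff₀ hpos]; nlinarith
  have h1 : HasDerivAt (fun τ : ℝ => 1 / τ - τ) (-(tanhHalf t ^ 2)⁻¹ - 1) (tanhHalf t) := by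
    simpa only [one_div] using (hasDerivAt_inv hpos.ne').fun_sub (hasDerivAt_id' _)
  have h2 : HasDerivAt (fun τ : ℝ => mehlerExponent τ x y)
      (((x - y) ^ 2 * -(tanhHalf t ^ 2)⁻¹ + (x + y) ^ 2) / 4) (tanhHalf t) := by
    unfold mehlerExponent
    simp only [div_eq_mul_inv]
    simpa using ((((hasDerivAt_inv hpos.ne').const_mul ((x - y) ^ 2)).add
      ((hasDerivAt_id (tanhHalf t)).mul_const ((x + y) ^ 2))).mul_const (4⁻¹ : ℝ))
  have h3 := (((h1.sqrt hg.ne').mul h2.fun_neg.exp).const_mul (1 / (2 * √Real.pi))).comp t hT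
  refine h3.congr_deriv ?_
  have hs : 1 - tanhHalf t ^ 2 =
      tanhHalf t * √(1 / tanhHalf t - tanhHalf t) ^ 2 := by
    rw [Real.sq_sqrt hg.le]; field_simp
  have hsp := Real.sqrt_pos.2 hg
  have hpi := Real.sqrt_pos.2 Real.pi_pos
  unfold mehlerTimeFactor
  rw [hs]
  generalize √(1 / tanhHalf t - tanhHalf t) = g at *
  generalize tanhHalf t = τ at *
  generalize Real.exp _ = e at *
  field_simp
  ring

lemma hasDerivAt_mehlerTimeFactor_mul_exp (τ x y : ℝ) :
    HasDerivAt (fun u => mehlerTimeFactor τ u y * Real.exp (-mehlerExponent τ u y))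
      (mehlerMixedFactor τ x y * Real.exp (-mehlerExponent τ x y)) x := by
  have hm : HasDerivAt (fun u : ℝ => (u - y) ^ 2) (2 * (x - y)) x := by
    simpa using ((hasDerivAt_id x).sub_const y).fun_pow 2
  have hp : HasDerivAt (fun u : ℝ => (u + y) ^ 2) (2 * (x + y)) x := by
    simpa using ((hasDerivAt_id x).add_const y).fun_pow 2
  have hE : HasDerivAt (fun u => mehlerExponent τ u y) (((x - y) / τ + τ * (x + y)) / 2) x := by
    unfold mehlerExponent
    refine (((hm.div_const τ).add (hp.const_mul τ)).div_const 4).congr_deriv ?_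
    ring
  have hP : HasDerivAt (fun u => mehlerTimeFactor τ u y)
      (-(1 - τ ^ 2) * ((x + y) - (x - y) / τ ^ 2) / 2) x := by
    unfold mehlerTimeFactor
    refine ((((hp.sub (hm.div_const (τ ^ 2))).const_mul (1 - τ ^ 2)).div_const 4).const_sub
      (-(1 / τ + τ) / 2)).congr_deriv ?_
    ring
  refine (hP.mul hE.fun_neg.exp).congr_deriv ?_
  unfold mehlerMixedFactor
  ring

lemma mehlerExponent_nonneg {τ : ℝ} (hτ : 0 < τ) (x y : ℝ) : 0 ≤ mehlerExponent τ x y := by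
  unfold mehlerExponent
  positivity

lemma abs_mehlerTimeFactor_le {τ : ℝ} (hτ : 0 < τ) (hτ1 : τ < 1) (x y : ℝ) :
    |mehlerTimeFactor τ x y| ≤ (1 + mehlerExponent τ x y) / τ := by
  have hτ2 : τ ^ 2 < 1 := by nlinarith
  have e : (1 + mehlerExponent τ x y) / τ = 1 / τ + (x - y) ^ 2 / τ ^ 2 / 4 + (x + y) ^ 2 / 4 := by
    unfold mehlerExponent
    field_simp
    ring
  have h1 : 1 ≤ 1 / τ := by rw [le_div_iff₀ hτ]; linarith
  have hm : 0 ≤ (x - y) ^ 2 / τ ^ 2 := by positivity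
  have hp := sq_nonneg (x + y)
  rw [e]
  unfold mehlerTimeFactor
  generalize (x - y) ^ 2 / τ ^ 2 = a at *
  generalize (x + y) ^ 2 = b at *
  generalize 1 / τ = c at *
  have h2 := mul_nonneg (sq_nonneg τ) hm
  have h3 := mul_nonneg (sq_nonneg τ) hp
  have h4 := mul_nonneg (sub_pos.2 hτ2).le hm
  have h5 := mul_nonneg (sub_pos.2 hτ2).le hp
  rw [abs_le]
  constructor <;> nlinarith

lemma abs_mehlerMixedFactor_mul_le {τ : ℝ} (hτ : 0 < τ) (hτ1 : τ < 1) (x y : ℝ) :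
    |mehlerMixedFactor τ x y| * (√τ * τ) ≤ 2 * (1 + mehlerExponent τ x y) ^ 2 := by
  have hE := mehlerExponent_nonneg hτ x y
  have hτ2 : τ ^ 2 < 1 := by nlinarith
  set E := mehlerExponent τ x y with hEdef
  set V := (|x - y| / τ + |x + y|) / 2 with hV
  have hV0 : 0 ≤ V := by positivity
  have hVE : τ * V ^ 2 ≤ 2 * E := by
    have : 2 * E - τ * V ^ 2 = τ * (|x - y| / τ - |x + y|) ^ 2 / 4 := by
      rw [hEdef, hV, mehlerExponent, ← sq_abs (x - y), ← sq_abs (x + y)]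
      field_simp
      ring
    have h : 0 ≤ τ * (|x - y| / τ - |x + y|) ^ 2 / 4 := by positivity
    linarith
  have hVs : √τ * V ≤ 1 + E := by
    have h : (√τ * V) ^ 2 ≤ 2 * E := by rwa [mul_pow, Real.sq_sqrt hτ.le]
    nlinarith [sq_nonneg (√τ * V - 1)]
  have hEx : |((x - y) / τ + τ * (x + y)) / 2| ≤ V := by
    rw [abs_div, abs_two, hV]
    gcongr
    refine (abs_add_le _ _).trans ?_
    rw [abs_div, abs_mul, abs_of_pos hτ]
    gcongr
    exact mul_le_of_le_one_left (abs_nonneg _) hτ1.le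
  have hPx : |(-(1 - τ ^ 2) * ((x + y) - (x - y) / τ ^ 2) / 2)| ≤ V / τ := by
    have h1 : |(x + y) - (x - y) / τ ^ 2| ≤ 2 * V / τ := by
      refine (abs_sub _ _).trans ?_
      have h2 : 2 * V / τ = |x + y| / τ + |x - y| / τ ^ 2 := by
        rw [hV]; field_simp; ring
      rw [h2, abs_div, abs_of_pos (pow_pos hτ 2)]
      gcongr
      exact le_div_self (abs_nonneg _) hτ hτ1.le
    rw [abs_div, abs_two, abs_mul, abs_neg, abs_of_pos (by linarith : 0 < 1 - τ ^ 2)]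
    have h3 : (1 - τ ^ 2) * |(x + y) - (x - y) / τ ^ 2| ≤ 1 * (2 * V / τ) := by
      gcongr
      nlinarith [sq_nonneg τ]
    calc _ ≤ 1 * (2 * V / τ) / 2 := by gcongr
      _ = V / τ := by ring
  have hQ : |mehlerMixedFactor τ x y| ≤ V / τ + (1 + E) / τ * V := by
    unfold mehlerMixedFactor
    refine (abs_sub _ _).trans ?_
    rw [abs_mul (mehlerTimeFactor τ x y)]
    gcongr
    exact abs_mehlerTimeFactor_le hτ hτ1 x y
  calc |mehlerMixedFactor τ x y| * (√τ * τ) ≤ (V / τ + (1 + E) / τ * V) * (√τ * τ) := by gcongr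
    _ = (2 + E) * (√τ * V) := by field_simp; ring
    _ ≤ (2 + E) * (1 + E) := by gcongr
    _ ≤ 2 * (1 + E) ^ 2 := by nlinarith

lemma abs_mehlerTimeFactor_mul_le {τ : ℝ} (hτ : 0 < τ) (hτ1 : τ < 1) (x y : ℝ) :
    |mehlerTimeFactor τ x y| * (√τ * τ) ≤ 2 * (1 + mehlerExponent τ x y) ^ 2 := by
  have hE := mehlerExponent_nonneg hτ x y
  have hs : √τ ≤ 1 := Real.sqrt_le_one.2 hτ1.le
  calc |mehlerTimeFactor τ x y| * (√τ * τ)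
      ≤ (1 + mehlerExponent τ x y) / τ * (1 * τ) := by
        gcongr
        exact abs_mehlerTimeFactor_le hτ hτ1 x y
    _ = 1 + mehlerExponent τ x y := by field_simp
    _ ≤ 2 * (1 + mehlerExponent τ x y) ^ 2 := by nlinarith

lemma one_add_pow_four_mul_exp_neg_le {E : ℝ} (hE : 0 ≤ E) :
    (1 + E) ^ 4 * Real.exp (-E) ≤ 72 := by
  have h := Real.pow_div_factorial_le_exp (x := 1 + E) (by linarith) 4
  rw [Real.exp_add] at h
  have h1 := Real.exp_one_lt_d9
  have h2 := Real.exp_pos (-E)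
  have h3 : Real.exp E * Real.exp (-E) = 1 := by rw [← Real.exp_add]; simp
  have h4 : (Nat.factorial 4 : ℝ) = 24 := by norm_num [Nat.factorial]
  rw [h4, div_le_iff₀ (by norm_num)] at h
  calc (1 + E) ^ 4 * Real.exp (-E)
      ≤ (Real.exp 1 * Real.exp E * 24) * Real.exp (-E) := by gcongr
    _ = Real.exp 1 * 24 * (Real.exp E * Real.exp (-E)) := by ring
    _ ≤ 72 := by rw [h3]; linarith

/-- An integrable majorant in time for the derivatives of the Mehler kernel. -/
noncomputable def mehlerMajorant (δ t : ℝ) : ℝ :=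
  1152 * Real.exp (-(t / 2)) / (1 - Real.exp (-(t / 2)) + δ) ^ 2

lemma abs_sqrt_mul_exp_le_mehlerMajorant {t δ x y F : ℝ} (ht : 0 < t) (hδ : 0 < δ)
    (hxy : δ ≤ (x - y) ^ 2 / 2)
    (hF : |F| * (√(tanhHalf t) * tanhHalf t) ≤ 2 * (1 + mehlerExponent (tanhHalf t) x y) ^ 2) :
    |1 / (4 * √Real.pi) * √(1 / tanhHalf t - tanhHalf t) *
      (F * Real.exp (-mehlerExponent (tanhHalf t) x y))| ≤ mehlerMajorant δ t := by
  have hτ := tanhHalf_pos ht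
  have hτ1 := tanhHalf_lt_one t
  have hE := mehlerExponent_nonneg hτ x y
  have hS := sqrt_one_sub_tanhHalf_sq_le t
  have hL := half_one_sub_exp_le_tanhHalf ht
  have hρ := Real.exp_pos (-(t / 2))
  have hρ1 : Real.exp (-(t / 2)) < 1 := Real.exp_zero ▸ Real.exp_lt_exp.2 (by linarith)
  have hEτ : (x - y) ^ 2 / 4 ≤ tanhHalf t * mehlerExponent (tanhHalf t) x y := by
    have : tanhHalf t * mehlerExponent (tanhHalf t) x y =
        (x - y) ^ 2 / 4 + tanhHalf t ^ 2 * (x + y) ^ 2 / 4 := by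
      unfold mehlerExponent
      field_simp
    rw [this]
    have : 0 ≤ tanhHalf t ^ 2 * (x + y) ^ 2 / 4 := by positivity
    linarith
  have h72 := one_add_pow_four_mul_exp_neg_le hE
  have hpi : 1 / (4 * √Real.pi) ≤ 1 := by
    have : 1 ≤ √Real.pi := Real.one_le_sqrt.2 (by linarith [Real.pi_gt_three])
    rw [div_le_one (by positivity)]
    linarith
  have hg : √(1 / tanhHalf t - tanhHalf t) = √(1 - tanhHalf t ^ 2) / √(tanhHalf t) := by
    rw [← Real.sqrt_div' _ hτ.le]
    congr 1
    field_simp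
  rw [abs_mul, abs_mul, abs_mul, Real.abs_exp, abs_of_nonneg (Real.sqrt_nonneg _),
    abs_of_nonneg (by positivity : 0 ≤ 1 / (4 * √Real.pi)), hg]
  unfold mehlerMajorant
  have hsτ := Real.sqrt_pos.2 hτ
  have hss := Real.sq_sqrt hτ.le
  have he := Real.exp_pos (-mehlerExponent (tanhHalf t) x y)
  generalize mehlerExponent (tanhHalf t) x y = E at *
  generalize Real.exp (-(t / 2)) = ρ at *
  generalize Real.exp (-E) = e at *
  generalize tanhHalf t = τ at *
  have hden : (1 - ρ + δ) / 2 ≤ (1 + E) * τ := by linarith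
  have hden0 : 0 < (1 - ρ + δ) / 2 := by linarith
  calc 1 / (4 * √Real.pi) * (√(1 - τ ^ 2) / √τ) * (|F| * e)
      ≤ 1 * (√(1 - τ ^ 2) / √τ) * (|F| * e) := by gcongr
    _ = √(1 - τ ^ 2) * (|F| * (√τ * τ)) * e / τ ^ 2 := by
        field_simp
        rw [hss]
        ring
    _ ≤ (2 * ρ) * (2 * (1 + E) ^ 2) * e / τ ^ 2 := by gcongr
    _ = 4 * ρ * ((1 + E) ^ 4 * e) / ((1 + E) * τ) ^ 2 := by
        field_simp
        ring
    _ ≤ 4 * ρ * 72 / ((1 - ρ + δ) / 2) ^ 2 := by gcongr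
    _ = 1152 * ρ / (1 - ρ + δ) ^ 2 := by
        field_simp
        norm_num

lemma integral_mehlerMajorant {δ : ℝ} (hδ : 0 < δ) :
    IntegrableOn (mehlerMajorant δ) (Ioi 0) ∧
      ∫ t in Ioi (0 : ℝ), mehlerMajorant δ t ≤ 2304 / δ := by
  have hd : ∀ t ∈ Ici (0 : ℝ), HasDerivAt
      (fun s : ℝ => -2304 * (1 - Real.exp (-(s / 2)) + δ)⁻¹) (mehlerMajorant δ t) t := by
    intro t ht
    have hle : Real.exp (-(t / 2)) ≤ 1 := Real.exp_le_one_iff.2 (by linarith [mem_Ici.1 ht])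
    have h1 : HasDerivAt (fun s : ℝ => Real.exp (-(s / 2)))
        (Real.exp (-(t / 2)) * -(1 / 2)) t :=
      ((hasDerivAt_id' t).div_const 2).fun_neg.exp
    refine ((((h1.const_sub 1).add_const δ).fun_inv (by linarith)).const_mul
      (-2304)).congr_deriv ?_
    unfold mehlerMajorant
    ring
  have hpos : ∀ t ∈ Ioi (0 : ℝ), 0 ≤ mehlerMajorant δ t := by
    intro t _
    unfold mehlerMajorant
    positivity
  have hlim : Tendsto (fun s : ℝ => -2304 * (1 - Real.exp (-(s / 2)) + δ)⁻¹) atTop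
      (𝓝 (-2304 * (1 - 0 + δ)⁻¹)) := by
    have h : Tendsto (fun s : ℝ => Real.exp (-(s / 2))) atTop (𝓝 0) :=
      Real.tendsto_exp_neg_atTop_nhds_zero.comp (tendsto_id.atTop_div_const (by norm_num))
    exact (((h.const_sub 1).add_const δ).inv₀ (by linarith)).const_mul _
  refine ⟨integrableOn_Ioi_deriv_of_nonneg' hd hpos hlim, ?_⟩
  rw [integral_Ioi_of_hasDerivAt_of_nonneg' hd hpos hlim]
  have h : 0 ≤ (1 - 0 + δ)⁻¹ := by rw [inv_nonneg]; linarith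
  have h0 : Real.exp (-((0 : ℝ) / 2)) = 1 := by simp
  rw [h0, sub_self, zero_add, div_eq_mul_inv]
  linarith

lemma measurable_mehler_mul {P : ℝ → ℝ} (hP : Measurable P) (x y : ℝ) :
    Measurable fun t => 1 / (4 * √Real.pi) * √(1 / tanhHalf t - tanhHalf t) *
      (P (tanhHalf t) * Real.exp (-mehlerExponent (tanhHalf t) x y)) := by
  have := measurable_tanhHalf
  unfold mehlerExponent
  fun_prop

lemma measurable_mehlerTimeFactor (x y : ℝ) : Measurable fun τ => mehlerTimeFactor τ x y := by
  unfold mehlerTimeFactor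
  fun_prop

lemma measurable_mehlerMixedFactor (x y : ℝ) : Measurable fun τ => mehlerMixedFactor τ x y := by
  have := measurable_mehlerTimeFactor x y
  unfold mehlerMixedFactor
  fun_prop

lemma KH_eq_integral (φ : ℝ → ℂ) (x y : ℝ) :
    KH φ x y = ∫ t in Ioi (0 : ℝ), φ t *
      ((-(1 / (4 * √Real.pi) * √(1 / tanhHalf t - tanhHalf t) *
        (mehlerTimeFactor (tanhHalf t) x y *
          Real.exp (-mehlerExponent (tanhHalf t) x y))) : ℝ) : ℂ) := by
  refine setIntegral_congr_fun measurableSet_Ioi fun t ht => ?_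
  simp only [(hasDerivAt_WH_time ht x y).deriv]

lemma norm_mul_neg_ofReal_le {z : ℂ} {A r B : ℝ} (hz : ‖z‖ ≤ A) (hr : |r| ≤ B) :
    ‖z * ((-r : ℝ) : ℂ)‖ ≤ A * B := by
  rw [norm_mul, Complex.norm_real, norm_neg, Real.norm_eq_abs]
  exact mul_le_mul hz hr (abs_nonneg _) ((norm_nonneg _).trans hz)

lemma KH_differentiableAt_and_norm_deriv_le {φ : ℝ → ℂ} {A : ℝ} (hφ : Measurable φ) (hA : 0 < A)
    (hb : ∀ᵐ t ∂(volume.restrict (Ioi (0 : ℝ))), ‖φ t‖ ≤ A) {x y : ℝ} (hxy : x ≠ y) :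
    DifferentiableAt ℝ (fun u => KH φ u y) x ∧
      ‖deriv (fun u => KH φ u y) x‖ ≤ 18432 * A / (x - y) ^ 2 := by
  have hd : 0 < |x - y| := abs_pos.2 (sub_ne_zero.2 hxy)
  set δ := (x - y) ^ 2 / 8 with hδdef
  have hδ : 0 < δ := by rw [hδdef, ← sq_abs]; positivity
  have hball : ∀ u ∈ Metric.ball x (|x - y| / 2), δ ≤ (u - y) ^ 2 / 2 := by
    intro u hu
    rw [Metric.mem_ball, dist_comm, Real.dist_eq] at hu
    have h1 : |x - y| ≤ |x - u| + |u - y| := abs_sub_le _ _ _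
    rw [hδdef, ← sq_abs (x - y), ← sq_abs (u - y)]
    nlinarith
  obtain ⟨hint, hle⟩ := integral_mehlerMajorant hδ
  have hpos : ∀ᵐ t ∂(volume.restrict (Ioi (0 : ℝ))), 0 < t :=
    ae_restrict_mem measurableSet_Ioi
  have hx : x ∈ Metric.ball x (|x - y| / 2) := Metric.mem_ball_self (by positivity)
  have hmeas : ∀ u, Measurable fun t => φ t *
      ((-(1 / (4 * √Real.pi) * √(1 / tanhHalf t - tanhHalf t) *
        (mehlerTimeFactor (tanhHalf t) u y *
          Real.exp (-mehlerExponent (tanhHalf t) u y))) : ℝ) : ℂ) := fun u =>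
    hφ.mul (Complex.measurable_ofReal.comp
      (measurable_mehler_mul (measurable_mehlerTimeFactor u y) u y).neg)
  have hmeas' : Measurable fun t => φ t *
      ((-(1 / (4 * √Real.pi) * √(1 / tanhHalf t - tanhHalf t) *
        (mehlerMixedFactor (tanhHalf t) x y *
          Real.exp (-mehlerExponent (tanhHalf t) x y))) : ℝ) : ℂ) :=
    hφ.mul (Complex.measurable_ofReal.comp
      (measurable_mehler_mul (measurable_mehlerMixedFactor x y) x y).neg)
  have hbound : ∀ᵐ t ∂(volume.restrict (Ioi (0 : ℝ))), ∀ u ∈ Metric.ball x (|x - y| / 2),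
      ‖φ t * ((-(1 / (4 * √Real.pi) * √(1 / tanhHalf t - tanhHalf t) *
        (mehlerMixedFactor (tanhHalf t) u y *
          Real.exp (-mehlerExponent (tanhHalf t) u y))) : ℝ) : ℂ)‖ ≤
        A * mehlerMajorant δ t := by
    filter_upwards [hb, hpos] with t hbt ht u hu
    exact norm_mul_neg_ofReal_le hbt (abs_sqrt_mul_exp_le_mehlerMajorant ht hδ (hball u hu)
      (abs_mehlerMixedFactor_mul_le (tanhHalf_pos ht) (tanhHalf_lt_one t) u y))
  have hkey := (hasDerivAt_integral_of_dominated_loc_of_deriv_le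
    (μ := volume.restrict (Ioi (0 : ℝ))) (bound := fun t => A * mehlerMajorant δ t)
    (F := fun u t => φ t * ((-(1 / (4 * √Real.pi) * √(1 / tanhHalf t - tanhHalf t) *
        (mehlerTimeFactor (tanhHalf t) u y *
          Real.exp (-mehlerExponent (tanhHalf t) u y))) : ℝ) : ℂ))
    (F' := fun u t => φ t * ((-(1 / (4 * √Real.pi) * √(1 / tanhHalf t - tanhHalf t) *
        (mehlerMixedFactor (tanhHalf t) u y *
          Real.exp (-mehlerExponent (tanhHalf t) u y))) : ℝ) : ℂ))
    (Metric.ball_mem_nhds x (by positivity : 0 < |x - y| / 2))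
    (Eventually.of_forall fun u => (hmeas u).aestronglyMeasurable)
    ((hint.const_mul A).mono' (hmeas x).aestronglyMeasurable ?_)
    hmeas'.aestronglyMeasurable hbound (hint.const_mul A) ?_).2
  · have heq : (fun u => KH φ u y) = _ := funext fun u => KH_eq_integral φ u y
    rw [← heq] at hkey
    refine ⟨hkey.differentiableAt, ?_⟩
    rw [hkey.deriv]
    calc _ ≤ ∫ t in Ioi (0 : ℝ), A * mehlerMajorant δ t :=
          norm_integral_le_of_norm_le (hint.const_mul A) (hbound.mono fun t ht => ht x hx)
      _ = A * ∫ t in Ioi (0 : ℝ), mehlerMajorant δ t := integral_const_mul _ _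
      _ ≤ A * (2304 / δ) := by gcongr
      _ = 18432 * A / (x - y) ^ 2 := by
          rw [hδdef]
          field_simp
          norm_num
  · filter_upwards [hb, hpos] with t hbt ht
    exact norm_mul_neg_ofReal_le hbt (abs_sqrt_mul_exp_le_mehlerMajorant ht hδ (hball x hx)
      (abs_mehlerTimeFactor_mul_le (tanhHalf_pos ht) (tanhHalf_lt_one t) x y))
  · refine Eventually.of_forall fun t u _ => HasDerivAt.const_mul (φ t) ?_
    exact ((hasDerivAt_mehlerTimeFactor_mul_exp (tanhHalf t) u y).const_mul _).fun_neg.ofReal_comp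

theorem hermite_kernel_CZ_gradient_estimate :
    ∃ C > (0:ℝ), ∀ (φ : ℝ → ℂ) (A : ℝ), Measurable φ → 0 < A →
      (∀ᵐ t ∂(volume.restrict (Set.Ioi (0:ℝ))), ‖φ t‖ ≤ A) →
      ∀ x y : ℝ, x ≠ y →
        (DifferentiableAt ℝ (fun u => KH φ u y) x ∧
          ‖deriv (fun u => KH φ u y) x‖ ≤ C * A / (x - y)^2) ∧
        (DifferentiableAt ℝ (fun v => KH φ x v) y ∧
          ‖deriv (fun v => KH φ x v) y‖ ≤ C * A / (x - y)^2) := by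
  refine ⟨18432, by norm_num, fun φ A hφ hA hb x y hxy =>
    ⟨KH_differentiableAt_and_norm_deriv_le hφ hA hb hxy, ?_⟩⟩
  simp_rw [KH_comm φ x]
  rw [← neg_sub y x, neg_sq]
  exact KH_differentiableAt_and_norm_deriv_le hφ hA hb hxy.symm
end

section
/- Let α > -1/2. There is a constant C > 0 (depending only on α) such that for every measurable function φ : (0,∞) → ℂ, every A > 0 with |φ(t)| ≤ A for almost every t > 0, and all x, y > 0 with either 0 < y < x/2 or 0 < 2x < y, the integral defining K_φ^{L_α}(x,y) converges absolutely and |K_φ^{L_α}(x,y)| ≤ C · A · (min{x,y})^{α+1/2} / (max{x,y})^{α+3/2}. -/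
open MeasureTheory Set

/-- The modified Bessel function of the first kind and order `α`. -/
noncomputable def besselI (α z : ℝ) : ℝ :=
  ∑' k : ℕ, (z/2) ^ (2*(k:ℝ) + α) / ((k.factorial : ℝ) * Real.Gamma ((k:ℝ) + α + 1))

/-- The Laguerre heat kernel `W_t^{L_α}(x,y)`. -/
noncomputable def WLa (α t x y : ℝ) : ℝ :=
  Real.sqrt (2 * Real.exp (-t) / (1 - Real.exp (-2*t))) *
    Real.sqrt (2*x*y*Real.exp (-t) / (1 - Real.exp (-2*t))) *
    besselI α (2*x*y*Real.exp (-t) / (1 - Real.exp (-2*t))) *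
    Real.exp (-((x^2 + y^2) * (1 + Real.exp (-2*t)) / (2 * (1 - Real.exp (-2*t)))))

/-- The kernel `K_φ^{L_α}(x,y) = ∫_0^∞ φ(t) (-∂_t W_t^{L_α}(x,y)) dt`. -/
noncomputable def KLa (α : ℝ) (φ : ℝ → ℂ) (x y : ℝ) : ℂ :=
  ∫ t in Set.Ioi (0:ℝ), φ t * ((-(deriv (fun s => WLa α s x y) t) : ℝ) : ℂ)

/-- Coefficients of the power series of `z ↦ (z/2)^(-α) I_α(z)` in the variable `(z/2)^2`. -/
noncomputable def besselCoeff (α : ℝ) (k : ℕ) : ℝ :=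
  1 / ((k.factorial : ℝ) * Real.Gamma ((k:ℝ) + α + 1))

/-- The entire function `h` with `I_α(z) = (z/2)^α h((z/2)^2)`. -/
noncomputable def besselEntire (α w : ℝ) : ℝ := ∑' k : ℕ, besselCoeff α k * w ^ k

lemma besselCoeff_pos {α : ℝ} (hα : -1 < α) (k : ℕ) : 0 < besselCoeff α k := by
  have : 0 < Real.Gamma ((k:ℝ) + α + 1) :=
    Real.Gamma_pos_of_pos (by have : (0:ℝ) ≤ k := k.cast_nonneg; linarith)
  unfold besselCoeff
  positivity

lemma besselCoeff_succ {α : ℝ} (hα : -1 < α) (k : ℕ) :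
    besselCoeff α (k + 1) = besselCoeff α k / ((k + 1) * (k + α + 1)) := by
  have h0 : (0:ℝ) < k + α + 1 := by have : (0:ℝ) ≤ k := k.cast_nonneg; linarith
  have hG := Real.Gamma_pos_of_pos h0
  unfold besselCoeff
  have : ((k + 1 : ℕ) : ℝ) + α + 1 = (k + α + 1) + 1 := by push_cast; ring
  rw [this, Real.Gamma_add_one h0.ne', Nat.factorial_succ]
  push_cast
  field_simp

lemma succ_mul_besselCoeff_succ (α : ℝ) (k : ℕ) :
    ((k : ℝ) + 1) * besselCoeff α (k + 1) = besselCoeff (α + 1) k := by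
  unfold besselCoeff
  have : ((k + 1 : ℕ) : ℝ) + α + 1 = k + (α + 1) + 1 := by push_cast; ring
  have hk : (k : ℝ) + 1 ≠ 0 := by positivity
  rw [this, Nat.factorial_succ]
  push_cast
  rw [mul_one_div, mul_assoc, ← div_div, div_self hk]

lemma besselCoeff_le {α : ℝ} (hα : -1/2 < α) (k : ℕ) :
    besselCoeff α k ≤ (Real.Gamma (α + 1))⁻¹ * (4 ^ k / ((2 * k).factorial : ℝ)) := by
  have hG : 0 < Real.Gamma (α + 1) := Real.Gamma_pos_of_pos (by linarith)
  induction k with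
  | zero => simp [besselCoeff]
  | succ k ih =>
    have hk : (0:ℝ) ≤ k := k.cast_nonneg
    rw [besselCoeff_succ (by linarith)]
    have e : 2 * (k + 1) = 2 * k + 1 + 1 := by ring
    have e2 : (Real.Gamma (α + 1))⁻¹ * (4 ^ (k + 1) / ((2 * (k + 1)).factorial : ℝ))
        = (Real.Gamma (α + 1))⁻¹ * (4 ^ k / ((2 * k).factorial : ℝ)) /
          ((k + 1) * (k + 1 / 2)) := by
      rw [e, Nat.factorial_succ, Nat.factorial_succ]
      push_cast
      field_simp
      ring
    rw [e2]
    have : (k:ℝ) + 1 / 2 ≤ k + α + 1 := by linarith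
    gcongr

lemma summable_besselEntire_sq {α : ℝ} (hα : -1/2 < α) (z : ℝ) :
    Summable fun k : ℕ => besselCoeff α k * ((z / 2) ^ 2) ^ k := by
  refine Summable.of_nonneg_of_le (fun k => ?_) (fun k => ?_)
    ((Real.hasSum_cosh z).summable.mul_left (Real.Gamma (α + 1))⁻¹)
  · have := besselCoeff_pos (by linarith : -1 < α) k
    positivity
  · calc _ ≤ ((Real.Gamma (α + 1))⁻¹ * (4 ^ k / ((2 * k).factorial : ℝ))) * ((z / 2) ^ 2) ^ k := by
          gcongr
          exact besselCoeff_le hα k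
      _ = _ := by
          have : (z / 2) ^ 2 = z ^ 2 / 4 := by ring
          rw [this, div_pow, ← pow_mul]
          field_simp

lemma besselEntire_sq_nonneg {α : ℝ} (hα : -1/2 < α) (z : ℝ) :
    0 ≤ besselEntire α ((z / 2) ^ 2) :=
  tsum_nonneg fun k => by
    have := besselCoeff_pos (by linarith : -1 < α) k
    positivity

lemma besselEntire_sq_le {α : ℝ} (hα : -1/2 < α) {z : ℝ} (hz : 0 ≤ z) :
    besselEntire α ((z / 2) ^ 2) ≤ (Real.Gamma (α + 1))⁻¹ * Real.exp z := by
  have hG : 0 < Real.Gamma (α + 1) := Real.Gamma_pos_of_pos (by linarith)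
  have hc := (Real.hasSum_cosh z).mul_left (Real.Gamma (α + 1))⁻¹
  calc besselEntire α ((z / 2) ^ 2) ≤ (Real.Gamma (α + 1))⁻¹ * Real.cosh z := by
        rw [← hc.tsum_eq]
        refine Summable.tsum_le_tsum (fun k => ?_) (summable_besselEntire_sq hα z) hc.summable
        calc _ ≤ ((Real.Gamma (α + 1))⁻¹ * (4 ^ k / ((2 * k).factorial : ℝ))) *
              ((z / 2) ^ 2) ^ k := by
              gcongr
              exact besselCoeff_le hα k
          _ = _ := by
              have : (z / 2) ^ 2 = z ^ 2 / 4 := by ring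
              rw [this, div_pow, ← pow_mul]
              field_simp
    _ ≤ _ := by
        gcongr
        have := Real.sinh_nonneg_iff.2 hz
        rw [← Real.cosh_add_sinh]
        linarith

lemma hasDerivAt_besselEntire {α : ℝ} (hα : -1/2 < α) (w : ℝ) :
    HasDerivAt (besselEntire α) (besselEntire (α + 1) w) w := by
  have hsum : ∀ {β : ℝ}, -1/2 < β → ∀ {R : ℝ}, 0 ≤ R →
      Summable fun k : ℕ => besselCoeff β k * R ^ k := by
    intro β hβ R hR
    convert summable_besselEntire_sq hβ (2 * Real.sqrt R) using 3
    rw [mul_div_cancel_left₀ _ two_ne_zero, Real.sq_sqrt hR]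
  set R := |w| + 1
  have hR : 0 ≤ R := by positivity
  have hcoeff : ∀ k, 0 ≤ besselCoeff α k := fun k => (besselCoeff_pos (by linarith) k).le
  have hu : Summable fun k : ℕ => besselCoeff α k * (k * R ^ (k - 1)) := by
    rw [← summable_nat_add_iff 1]
    refine (hsum (by linarith : -1/2 < α + 1) hR).congr fun k => ?_
    rw [← succ_mul_besselCoeff_succ]
    push_cast
    ring
  have hmem : w ∈ Metric.ball (0:ℝ) R := by simp [R]
  have hbound : ∀ (n : ℕ), ∀ y ∈ Metric.ball (0:ℝ) R,
      ‖besselCoeff α n * (n * y ^ (n - 1))‖ ≤ besselCoeff α n * (n * R ^ (n - 1)) := by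
    intro n y hy
    have hy' : |y| ≤ R := by simpa using (Metric.mem_ball.1 hy).le
    rw [norm_mul, norm_mul, norm_pow, Real.norm_of_nonneg (hcoeff n), Real.norm_eq_abs y,
      Real.norm_of_nonneg n.cast_nonneg]
    have := hcoeff n
    gcongr
  have key := hasDerivAt_tsum_of_isPreconnected (g := fun (k : ℕ) w => besselCoeff α k * w ^ k)
    (g' := fun (k : ℕ) w => besselCoeff α k * (k * w ^ (k - 1))) (t := Metric.ball (0:ℝ) R)
    (y₀ := 0) hu Metric.isOpen_ball (convex_ball _ _).isPreconnected
    (fun n y _ => (hasDerivAt_pow n y).const_mul _) hbound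
    (Metric.mem_ball_self (by positivity)) (hsum hα le_rfl) hmem
  refine key.congr_deriv ?_
  have hs : Summable fun k : ℕ => besselCoeff α k * (k * w ^ (k - 1)) :=
    Summable.of_norm_bounded hu fun k => hbound k w hmem
  rw [hs.tsum_eq_zero_add, besselEntire]
  simp only [CharP.cast_eq_zero, zero_mul, mul_zero, zero_add]
  refine tsum_congr fun k => ?_
  rw [← succ_mul_besselCoeff_succ]
  push_cast
  ring

lemma besselI_eq (α : ℝ) {z : ℝ} (hz : 0 < z) :
    besselI α z = (z / 2) ^ α * besselEntire α ((z / 2) ^ 2) := by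
  rw [besselI, besselEntire, ← tsum_mul_left]
  refine tsum_congr fun k => ?_
  rw [Real.rpow_add (by positivity), besselCoeff, ← pow_mul]
  norm_cast
  ring

/-- The factor of the Laguerre heat kernel that depends on time, in hyperbolic form. -/
noncomputable def laguerreTimeFactor (α p Q t : ℝ) : ℝ :=
  Real.sinh t ^ (-(α + 1)) * besselEntire α ((p / Real.sinh t / 2) ^ 2) *
    Real.exp (-(Q * (Real.cosh t / Real.sinh t) / 2))

lemma two_mul_exp_neg_div {t : ℝ} (ht : 0 < t) :
    2 * Real.exp (-t) / (1 - Real.exp (-2 * t)) = (Real.sinh t)⁻¹ := by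
  have h1 : Real.exp t * Real.exp (-t) = 1 := by rw [← Real.exp_add]; simp
  have h2 : Real.exp (-2 * t) = Real.exp (-t) * Real.exp (-t) := by
    rw [← Real.exp_add]; ring_nf
  have hlt : Real.exp (-t) < 1 := by simpa using ht
  have hp := Real.exp_pos (-t)
  have hs : 0 < Real.sinh t := Real.sinh_pos_iff.2 ht
  have h3 : 1 - Real.exp (-2 * t) ≠ 0 := by rw [h2]; nlinarith
  rw [div_eq_iff h3, inv_mul_eq_div, eq_div_iff hs.ne', Real.sinh_eq, h2]
  linear_combination h1

lemma one_add_exp_div {t : ℝ} (ht : 0 < t) :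
    (1 + Real.exp (-2 * t)) / (1 - Real.exp (-2 * t)) = Real.cosh t / Real.sinh t := by
  have h1 : Real.exp t * Real.exp (-t) = 1 := by rw [← Real.exp_add]; simp
  have h2 : Real.exp (-2 * t) = Real.exp (-t) * Real.exp (-t) := by
    rw [← Real.exp_add]; ring_nf
  have hlt : Real.exp (-t) < 1 := by simpa using ht
  have hp := Real.exp_pos (-t)
  have hs : 0 < Real.sinh t := Real.sinh_pos_iff.2 ht
  have h3 : 1 - Real.exp (-2 * t) ≠ 0 := by rw [h2]; nlinarith
  rw [div_eq_div_iff h3 hs.ne', Real.sinh_eq, Real.cosh_eq, h2]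
  linear_combination Real.exp (-t) * h1

lemma WLa_eq (α : ℝ) {t x y : ℝ} (ht : 0 < t) (hx : 0 < x) (hy : 0 < y) :
    WLa α t x y = (x * y) ^ (α + 1/2) * 2 ^ (-α) *
      laguerreTimeFactor α (x * y) (x ^ 2 + y ^ 2) t := by
  have hs : 0 < Real.sinh t := Real.sinh_pos_iff.2 ht
  have hp : 0 < x * y := mul_pos hx hy
  have e1 : 2 * x * y * Real.exp (-t) / (1 - Real.exp (-2 * t)) = x * y / Real.sinh t := by
    rw [div_eq_mul_inv (x * y), ← two_mul_exp_neg_div ht]; ring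
  have e2 : (x ^ 2 + y ^ 2) * (1 + Real.exp (-2 * t)) / (2 * (1 - Real.exp (-2 * t))) =
      (x ^ 2 + y ^ 2) * (Real.cosh t / Real.sinh t) / 2 := by
    rw [← one_add_exp_div ht, mul_div_assoc', div_div, mul_comm (2:ℝ)]
  have e3 : √(Real.sinh t)⁻¹ * √(x * y / Real.sinh t) * (x * y / Real.sinh t / 2) ^ α =
      (x * y) ^ (α + 1/2) * 2 ^ (-α) * Real.sinh t ^ (-(α + 1)) := by
    rw [Real.sqrt_inv, Real.sqrt_div hp.le, Real.div_rpow (by positivity) (by norm_num),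
      Real.div_rpow hp.le hs.le, Real.rpow_add hp, ← Real.sqrt_eq_rpow, Real.rpow_neg hs.le,
      Real.rpow_neg (by norm_num), Real.rpow_add hs, Real.rpow_one]
    have hsq : 0 < √(Real.sinh t) := Real.sqrt_pos.2 hs
    field_simp
    rw [Real.sq_sqrt hs.le]
  rw [WLa, two_mul_exp_neg_div ht, e1, e2, besselI_eq α (by positivity), laguerreTimeFactor,
    ← mul_assoc, ← mul_assoc, ← mul_assoc, e3]

lemma hasDerivAt_laguerreTimeFactor {α : ℝ} (hα : -1/2 < α) (p Q : ℝ) {t : ℝ} (ht : 0 < t) :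
    HasDerivAt (laguerreTimeFactor α p Q)
      (Real.sinh t ^ (-(α + 2)) * Real.cosh t * Real.exp (-(Q * (Real.cosh t / Real.sinh t) / 2)) *
        (-(α + 1) * besselEntire α ((p / Real.sinh t / 2) ^ 2)
          - 2 * (p / Real.sinh t / 2) ^ 2 * besselEntire (α + 1) ((p / Real.sinh t / 2) ^ 2)
          + Q / Real.sinh t / 2 / Real.cosh t * besselEntire α ((p / Real.sinh t / 2) ^ 2))) t := by
  have hs : 0 < Real.sinh t := Real.sinh_pos_iff.2 ht
  have hc : 0 < Real.cosh t := Real.cosh_pos t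
  have hS := Real.hasDerivAt_sinh t
  have hC := Real.hasDerivAt_cosh t
  have h1 := hS.rpow_const (p := -(α + 1)) (Or.inl hs.ne')
  have hz := (((hasDerivAt_const t p).div hS hs.ne').div_const 2).pow 2
  have h2 := (hasDerivAt_besselEntire hα ((p / Real.sinh t / 2) ^ 2)).comp t hz
  have h3 := (((hC.div hS hs.ne').const_mul Q).div_const 2).neg.exp
  refine ((h1.mul h2).mul h3).congr_deriv ?_
  have e1 : Real.sinh t ^ (-(α + 1)) = Real.sinh t ^ (-(α + 2)) * Real.sinh t := by
    rw [← Real.rpow_add_one hs.ne']; ring_nf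
  have e2 : -(α + 1) - 1 = -(α + 2) := by ring
  have e3 : Real.sinh t * Real.sinh t = Real.cosh t ^ 2 - 1 := by rw [Real.cosh_sq]; ring
  have e4 : (Real.sinh t * Real.sinh t - Real.cosh t * Real.cosh t) = -1 := by rw [e3]; ring
  simp only [Pi.mul_apply, Pi.div_apply, Function.comp_apply, e1, e2, e4, Pi.pow_apply,
    Pi.neg_apply, Nat.cast_ofNat, Nat.add_one_sub_one, pow_one]
  generalize besselEntire α _ = g
  generalize besselEntire (α + 1) _ = g'
  field_simp
  ring

/-- The constant in the pointwise bound for the time derivative of the Laguerre heat kernel. -/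
noncomputable def laguerreDerivConst (α : ℝ) : ℝ :=
  ((Real.Gamma (α + 1))⁻¹ + (Real.Gamma (α + 2))⁻¹) * (α + 75)

lemma laguerreDerivConst_pos {α : ℝ} (hα : -1/2 < α) : 0 < laguerreDerivConst α := by
  have h1 : 0 < Real.Gamma (α + 1) := Real.Gamma_pos_of_pos (by linarith)
  have h2 : 0 < Real.Gamma (α + 2) := Real.Gamma_pos_of_pos (by linarith)
  have h3 : 0 < α + 75 := by linarith
  unfold laguerreDerivConst
  positivity

lemma abs_deriv_laguerreTimeFactor_le {α : ℝ} (hα : -1/2 < α) {p Q t : ℝ} (hp : 0 ≤ p)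
    (hpQ : p ≤ 2 / 5 * Q) (ht : 0 < t) :
    |deriv (laguerreTimeFactor α p Q) t| ≤ laguerreDerivConst α *
      (Real.sinh t ^ (-(α + 2)) * Real.cosh t * Real.exp (-(Q / 20 * (Real.sinh t)⁻¹))) := by
  have hs : 0 < Real.sinh t := Real.sinh_pos_iff.2 ht
  have hc : 1 ≤ Real.cosh t := Real.one_le_cosh t
  have hQ : 0 ≤ Q := by linarith
  rw [(hasDerivAt_laguerreTimeFactor hα p Q ht).deriv]
  set S := Real.sinh t
  set c := Real.cosh t
  set z := p / S with hz
  set P := Q / S with hP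
  have hz0 : 0 ≤ z := by positivity
  have hP0 : 0 ≤ P := by positivity
  have hzP : z ≤ 2 / 5 * P := by
    rw [hz, hP, mul_div_assoc']; gcongr
  have hG1 : 0 < Real.Gamma (α + 1) := Real.Gamma_pos_of_pos (by linarith)
  have hG2 : 0 < Real.Gamma (α + 2) := Real.Gamma_pos_of_pos (by linarith)
  set K := (Real.Gamma (α + 1))⁻¹ + (Real.Gamma (α + 2))⁻¹ with hK
  have hK0 : 0 < K := by positivity
  have b1 : besselEntire α ((z / 2) ^ 2) ≤ K * Real.exp z :=
    (besselEntire_sq_le hα hz0).trans (by gcongr; simp [hK, hG2.le])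
  have b2 : besselEntire (α + 1) ((z / 2) ^ 2) ≤ K * Real.exp z :=
    (besselEntire_sq_le (by linarith) hz0).trans (by
      rw [add_assoc, one_add_one_eq_two]; gcongr; simp [hK, hG1.le])
  have n1 := besselEntire_sq_nonneg hα z
  have n2 := besselEntire_sq_nonneg (by linarith : -1/2 < α + 1) z
  set g := besselEntire α ((z / 2) ^ 2)
  set g' := besselEntire (α + 1) ((z / 2) ^ 2)
  have hPc : P / 2 / c ≤ P / 2 := div_le_self (by positivity) hc
  have hbr : |-(α + 1) * g - 2 * (z / 2) ^ 2 * g' + P / 2 / c * g| ≤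
      K * Real.exp z * ((α + 75) * Real.exp (P / 20)) := by
    calc _ ≤ (α + 1) * g + 2 * (z / 2) ^ 2 * g' + P / 2 / c * g := by
          have m1 : 0 ≤ (α + 1) * g := mul_nonneg (by linarith) n1
          have m2 : 0 ≤ 2 * (z / 2) ^ 2 * g' := by positivity
          have m3 : 0 ≤ P / 2 / c * g := by positivity
          rw [abs_le]; constructor <;> linarith
      _ ≤ (α + 1) * (K * Real.exp z) + 2 * (2 / 5 * P / 2) ^ 2 * (K * Real.exp z) +
            P / 2 * (K * Real.exp z) := by
          have : 0 ≤ α + 1 := by linarith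
          gcongr
      _ = K * Real.exp z * ((α + 1) + 2 / 25 * P ^ 2 + P / 2) := by ring
      _ ≤ _ := by
          gcongr
          have hq := Real.quadratic_le_exp_of_nonneg (by positivity : 0 ≤ P / 20)
          have h0 : 0 ≤ P / 20 := by positivity
          nlinarith [mul_nonneg (by linarith : 0 ≤ α + 1) (by nlinarith : 0 ≤ Real.exp (P / 20) - 1)]
  have hexp : Real.exp (-(Q * (c / S) / 2)) * Real.exp z * Real.exp (P / 20) ≤
      Real.exp (-(Q / 20 * S⁻¹)) := by
    rw [← Real.exp_add, ← Real.exp_add]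
    apply Real.exp_le_exp.2
    have e1 : Q * (c / S) = P * c := by rw [hP]; ring
    have e2 : Q / 20 * S⁻¹ = P / 20 := by rw [hP]; ring
    rw [e1, e2]
    nlinarith
  rw [abs_mul, abs_of_nonneg (by positivity)]
  have hα75 : 0 < α + 75 := by linarith
  calc _ ≤ S ^ (-(α + 2)) * c * Real.exp (-(Q * (c / S) / 2)) *
        (K * Real.exp z * ((α + 75) * Real.exp (P / 20))) := by gcongr
    _ = K * (α + 75) * (S ^ (-(α + 2)) * c *
        (Real.exp (-(Q * (c / S) / 2)) * Real.exp z * Real.exp (P / 20))) := by ring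
    _ ≤ _ := by rw [laguerreDerivConst, ← hK]; gcongr

lemma image_inv_sinh_Ioi : (fun t => (Real.sinh t)⁻¹) '' Ioi (0:ℝ) = Ioi 0 := by
  ext v
  constructor
  · rintro ⟨t, ht, rfl⟩
    exact inv_pos.2 (Real.sinh_pos_iff.2 ht)
  · intro hv
    obtain ⟨t, ht⟩ := Real.sinh_surjective v⁻¹
    exact ⟨t, Real.sinh_pos_iff.1 (ht ▸ inv_pos.2 hv), by simp [ht]⟩

/-- The substitution `v = 1 / sinh t` turns the integral into a Gamma integral. -/
lemma integral_sinh_rpow_mul_exp {α c : ℝ} (hα : -1 < α) (hc : 0 < c) :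
    IntegrableOn (fun t => Real.sinh t ^ (-(α + 2)) * Real.cosh t *
        Real.exp (-(c * (Real.sinh t)⁻¹))) (Ioi 0) ∧
      ∫ t in Ioi (0:ℝ), Real.sinh t ^ (-(α + 2)) * Real.cosh t *
        Real.exp (-(c * (Real.sinh t)⁻¹)) = (1 / c) ^ (α + 1) * Real.Gamma (α + 1) := by
  have hderiv : ∀ t ∈ Ioi (0:ℝ), HasDerivWithinAt (fun t => (Real.sinh t)⁻¹)
      (-Real.cosh t / Real.sinh t ^ 2) (Ioi 0) t := fun t ht =>
    ((Real.hasDerivAt_sinh t).inv (Real.sinh_pos_iff.2 ht).ne').hasDerivWithinAt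
  have hinj : InjOn (fun t => (Real.sinh t)⁻¹) (Ioi (0:ℝ)) := fun a _ b _ h =>
    Real.sinh_injective (inv_injective h)
  set G : ℝ → ℝ := fun v => v ^ α * Real.exp (-(c * v))
  have hcongr : ∀ t ∈ Ioi (0:ℝ), |-Real.cosh t / Real.sinh t ^ 2| • G (Real.sinh t)⁻¹ =
      Real.sinh t ^ (-(α + 2)) * Real.cosh t * Real.exp (-(c * (Real.sinh t)⁻¹)) := by
    intro t ht
    have hs : 0 < Real.sinh t := Real.sinh_pos_iff.2 ht
    have hC := Real.cosh_pos t
    rw [neg_div, abs_neg, abs_of_pos (by positivity), smul_eq_mul]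
    simp only [G]
    rw [Real.inv_rpow hs.le, Real.rpow_neg hs.le, Real.rpow_add hs, Real.rpow_two]
    field_simp
  constructor
  · have hint : IntegrableOn G (Ioi 0) := by
      refine (integrableOn_rpow_mul_exp_neg_mul_rpow hα one_pos hc).congr_fun (fun v _ => ?_)
        measurableSet_Ioi
      simp [G]
    rw [← image_inv_sinh_Ioi, integrableOn_image_iff_integrableOn_abs_deriv_smul
      measurableSet_Ioi hderiv hinj] at hint
    exact hint.congr_fun hcongr measurableSet_Ioi
  · rw [← setIntegral_congr_fun measurableSet_Ioi hcongr,
      ← integral_image_eq_integral_abs_deriv_smul measurableSet_Ioi hderiv hinj,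
      image_inv_sinh_Ioi, ← Real.integral_rpow_mul_exp_neg_mul_Ioi (by linarith) hc]
    simp [G]

lemma abs_deriv_WLa_le {α : ℝ} (hα : -1/2 < α) {x y t : ℝ} (hx : 0 < x) (hy : 0 < y)
    (hxy : x * y ≤ 2 / 5 * (x ^ 2 + y ^ 2)) (ht : 0 < t) :
    |deriv (fun s => WLa α s x y) t| ≤ (x * y) ^ (α + 1/2) * 2 ^ (-α) * laguerreDerivConst α *
      (Real.sinh t ^ (-(α + 2)) * Real.cosh t *
        Real.exp (-((x ^ 2 + y ^ 2) / 20 * (Real.sinh t)⁻¹))) := by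
  have hev : (fun s => WLa α s x y) =ᶠ[nhds t] fun s => (x * y) ^ (α + 1/2) * 2 ^ (-α) *
      laguerreTimeFactor α (x * y) (x ^ 2 + y ^ 2) s := by
    filter_upwards [Ioi_mem_nhds ht] with s hs using WLa_eq α hs hx hy
  rw [hev.deriv_eq, deriv_const_mul _
    (hasDerivAt_laguerreTimeFactor hα _ _ ht).differentiableAt, abs_mul,
    abs_of_nonneg (by positivity), mul_assoc (_ * _)]
  gcongr
  exact abs_deriv_laguerreTimeFactor_le hα (by positivity) hxy ht

lemma mul_rpow_mul_inv_rpow_le {α x y : ℝ} (hα : -1/2 < α) (hx : 0 < x) (hy : 0 < y) :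
    (x * y) ^ (α + 1/2) * (1 / ((x ^ 2 + y ^ 2) / 20)) ^ (α + 1) ≤
      20 ^ (α + 1) * ((min x y) ^ (α + 1/2) / (max x y) ^ (α + 3/2)) := by
  have hm : 0 < min x y := lt_min hx hy
  have hM : 0 < max x y := lt_max_of_lt_left hx
  have hα1 : 0 ≤ α + 1 := by linarith
  have hQ : max x y ^ 2 ≤ x ^ 2 + y ^ 2 := by
    rcases max_choice x y with h | h <;> rw [h] <;> nlinarith [sq_nonneg x, sq_nonneg y]
  have e : max x y ^ (α + 1/2) * (1 / (max x y ^ 2 / 20)) ^ (α + 1) =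
      20 ^ (α + 1) / max x y ^ (α + 3/2) := by
    rw [one_div_div, Real.div_rpow (by norm_num) (by positivity), ← Real.rpow_natCast,
      ← Real.rpow_mul hM.le, mul_div_assoc', div_eq_div_iff (by positivity) (by positivity),
      mul_comm (max x y ^ (α + 1/2)), mul_assoc, ← Real.rpow_add hM]
    congr 2
    push_cast
    ring
  calc _ ≤ (x * y) ^ (α + 1/2) * (1 / (max x y ^ 2 / 20)) ^ (α + 1) := by gcongr
    _ = (min x y) ^ (α + 1/2) *
        (max x y ^ (α + 1/2) * (1 / (max x y ^ 2 / 20)) ^ (α + 1)) := by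
        rw [← min_mul_max x y, Real.mul_rpow hm.le hM.le, mul_assoc]
    _ = _ := by rw [e]; ring

theorem laguerre_kernel_offdiagonal_estimate (α : ℝ) (hα : -1/2 < α) :
    ∃ C > (0:ℝ), ∀ (φ : ℝ → ℂ) (A : ℝ), Measurable φ → 0 < A →
      (∀ᵐ t ∂(volume.restrict (Set.Ioi (0:ℝ))), ‖φ t‖ ≤ A) →
      ∀ x y : ℝ, ((0 < y ∧ y < x/2) ∨ (0 < x ∧ 2*x < y)) →
        IntegrableOn (fun t => φ t * ((-(deriv (fun s => WLa α s x y) t) : ℝ) : ℂ))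
          (Set.Ioi (0:ℝ)) ∧
        ‖KLa α φ x y‖ ≤ C * A * (min x y) ^ (α + 1/2) / (max x y) ^ (α + 3/2) := by
  have hD := laguerreDerivConst_pos hα
  have hG : 0 < Real.Gamma (α + 1) := Real.Gamma_pos_of_pos (by linarith)
  refine ⟨2 ^ (-α) * laguerreDerivConst α * Real.Gamma (α + 1) * 20 ^ (α + 1), by positivity, ?_⟩
  intro φ A hφ hA hbd x y hxy
  have hx : 0 < x := by rcases hxy with h | h <;> linarith
  have hy : 0 < y := by rcases hxy with h | h <;> linarith
  have hoff : x * y ≤ 2 / 5 * (x ^ 2 + y ^ 2) := by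
    rcases hxy with h | h
    · nlinarith [mul_pos (by linarith : 0 < x - 2 * y) (by linarith : 0 < 2 * x - y)]
    · nlinarith [mul_pos (by linarith : 0 < y - 2 * x) (by linarith : 0 < 2 * y - x)]
  obtain ⟨hint, hval⟩ := integral_sinh_rpow_mul_exp (by linarith : -1 < α)
    (by positivity : 0 < (x ^ 2 + y ^ 2) / 20)
  set B := (x * y) ^ (α + 1/2) * 2 ^ (-α) * laguerreDerivConst α with hB
  have hdom := hint.const_mul (A * B)
  have hle : ∀ᵐ t ∂(volume.restrict (Ioi (0:ℝ))),
      ‖φ t * ((-(deriv (fun s => WLa α s x y) t) : ℝ) : ℂ)‖ ≤ A * B *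
        (Real.sinh t ^ (-(α + 2)) * Real.cosh t *
          Real.exp (-((x ^ 2 + y ^ 2) / 20 * (Real.sinh t)⁻¹))) := by
    filter_upwards [hbd, ae_restrict_mem measurableSet_Ioi] with t h1 ht
    rw [norm_mul, Complex.norm_real, norm_neg, Real.norm_eq_abs, mul_assoc A]
    gcongr
    exact abs_deriv_WLa_le hα hx hy hoff ht
  refine ⟨hdom.mono' ?_ hle, ?_⟩
  · exact (hφ.mul (Complex.measurable_ofReal.comp
      (measurable_deriv fun s => WLa α s x y).neg)).aestronglyMeasurable
  · calc ‖KLa α φ x y‖ ≤ _ := norm_integral_le_of_norm_le hdom hle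
      _ = A * (2 ^ (-α) * laguerreDerivConst α * Real.Gamma (α + 1)) *
          ((x * y) ^ (α + 1/2) * (1 / ((x ^ 2 + y ^ 2) / 20)) ^ (α + 1)) := by
          rw [integral_const_mul, hval, hB]; ring
      _ ≤ A * (2 ^ (-α) * laguerreDerivConst α * Real.Gamma (α + 1)) *
          (20 ^ (α + 1) * ((min x y) ^ (α + 1/2) / (max x y) ^ (α + 3/2))) := by
          exact mul_le_mul_of_nonneg_left (mul_rpow_mul_inv_rpow_le hα hx hy) (by positivity)
      _ = _ := by ring
end

section
/- Let α > -1/2. There is a constant C > 0 (depending only on α) such that for every x > 0, ∫_0^∞ e^{-x²/(8t)} · e^{-(α+1)t} · (1-e^{-2t})^{-(α+2)} dt ≤ C · x^{-2α-2}. -/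
open MeasureTheory Set

/-- The substitution `t ↦ 1 / t` applied to the integrand of the Gamma function. -/
lemma inv_rpow_gamma_integrand {b r t : ℝ} (ht : 0 < t) :
    (|(-1 : ℝ)| * t ^ ((-1 : ℝ) - 1)) • ((t ^ (-1 : ℝ)) ^ (b - 1) * Real.exp (-(r * t ^ (-1 : ℝ)))) =
      t ^ (-(b + 1)) * Real.exp (-r / t) := by
  rw [← Real.rpow_mul ht.le, smul_eq_mul, abs_neg, abs_one, one_mul, ← mul_assoc,
    ← Real.rpow_add ht, Real.rpow_neg_one]
  ring_nf

lemma integral_rpow_mul_exp_neg_div_Ioi {b r : ℝ} (hb : 0 < b) (hr : 0 < r) :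
    ∫ t in Ioi (0 : ℝ), t ^ (-(b + 1)) * Real.exp (-r / t) = (1 / r) ^ b * Real.Gamma b := by
  rw [← Real.integral_rpow_mul_exp_neg_mul_Ioi hb hr]
  refine Eq.trans ?_ (integral_comp_rpow_Ioi (fun t : ℝ => t ^ (b - 1) * Real.exp (-(r * t)))
    (show (-1 : ℝ) ≠ 0 by norm_num))
  exact setIntegral_congr_fun measurableSet_Ioi fun t ht => (inv_rpow_gamma_integrand ht).symm

lemma integrableOn_rpow_mul_exp_neg_div_Ioi {b r : ℝ} (hb : 0 < b) (hr : 0 < r) :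
    IntegrableOn (fun t : ℝ => t ^ (-(b + 1)) * Real.exp (-r / t)) (Ioi 0) := by
  by_contra h
  have h₁ := integral_rpow_mul_exp_neg_div_Ioi hb hr
  rw [integral_undef h] at h₁
  have : 0 < (1 / r) ^ b * Real.Gamma b :=
    mul_pos (Real.rpow_pos_of_pos (by positivity) _) (Real.Gamma_pos_of_pos hb)
  linarith

/-- For every rate `c > 0`, `1 - e^{-2t}` dominates a multiple of `t e^{-ct}`. -/
lemma mul_exp_neg_le_one_sub_exp {c t : ℝ} (hc : 0 < c) (ht : 0 < t) :
    2 / (1 + 2 / c) * (t * Real.exp (-(c * t))) ≤ 1 - Real.exp (-2 * t) := by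
  have h₁ : 1 + 2 * t ≤ (1 + 2 / c) * Real.exp (c * t) := by
    have h : (1 + 2 / c) * (c * t + 1) ≤ (1 + 2 / c) * Real.exp (c * t) :=
      mul_le_mul_of_nonneg_left (Real.add_one_le_exp _) (by positivity)
    have e : (1 + 2 / c) * (c * t + 1) = 1 + 2 * t + (c * t + 2 / c) := by
      field_simp
      ring
    have : 0 < c * t + 2 / c := by positivity
    linarith
  have h₂ : Real.exp (-2 * t) ≤ 1 / (1 + 2 * t) := by
    rw [neg_mul, Real.exp_neg, ← one_div]
    exact one_div_le_one_div_of_le (by positivity) (by linarith [Real.add_one_le_exp (2 * t)])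
  have h₃ : 2 / (1 + 2 / c) * (t * Real.exp (-(c * t))) =
      2 * t / ((1 + 2 / c) * Real.exp (c * t)) := by
    rw [Real.exp_neg]
    field_simp
  have h₄ : 2 * t / ((1 + 2 / c) * Real.exp (c * t)) ≤ 2 * t / (1 + 2 * t) :=
    div_le_div_of_nonneg_left (by positivity) (by positivity) h₁
  have h₅ : 2 * t / (1 + 2 * t) = 1 - 1 / (1 + 2 * t) := by
    field_simp
    ring
  linarith

lemma exp_mul_one_sub_exp_rpow_le {b t : ℝ} (hb : 0 < b) (ht : 0 < t) :
    Real.exp (-b * t) * (1 - Real.exp (-2 * t)) ^ (-(b + 1)) ≤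
      (2 / (1 + 2 / (b / (b + 1)))) ^ (-(b + 1)) * t ^ (-(b + 1)) := by
  have hc : 0 < b / (b + 1) := by positivity
  have h := Real.rpow_le_rpow_of_nonpos (by positivity) (mul_exp_neg_le_one_sub_exp hc ht)
    (show -(b + 1) ≤ 0 by linarith)
  rw [Real.mul_rpow (by positivity) (by positivity), Real.mul_rpow ht.le (by positivity),
    ← Real.exp_mul, show -(b / (b + 1) * t) * -(b + 1) = b * t by field_simp] at h
  refine (mul_le_mul_of_nonneg_left h (Real.exp_pos _).le).trans_eq ?_
  have : Real.exp (-b * t) * Real.exp (b * t) = 1 := by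
    rw [← Real.exp_add]
    simp
  linear_combination
    (2 / (1 + 2 / (b / (b + 1)))) ^ (-(b + 1)) * t ^ (-(b + 1)) * this

theorem laguerre_local_integral_estimate (α : ℝ) (hα : -1/2 < α) :
    ∃ C > (0:ℝ), ∀ x : ℝ, 0 < x →
      (∫ t in Set.Ioi (0:ℝ),
        Real.exp (-x^2 / (8*t)) * Real.exp (-(α+1)*t) *
          (1 - Real.exp (-2*t)) ^ (-(α+2))) ≤ C * x ^ (-2*α - 2) := by
  obtain ⟨b, rfl⟩ : ∃ b, α = b - 1 := ⟨α + 1, by ring⟩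
  have hb : 0 < b := by linarith
  rw [show b - 1 + 1 = b by ring, show b - 1 + 2 = b + 1 by ring,
    show -2 * (b - 1) - 2 = 2 * -b by ring]
  set K : ℝ := (2 / (1 + 2 / (b / (b + 1)))) ^ (-(b + 1)) with hK
  have hK_pos : 0 < K := Real.rpow_pos_of_pos (by positivity) _
  have hΓ := Real.Gamma_pos_of_pos hb
  refine ⟨K * (8 ^ b * Real.Gamma b), by positivity, fun x hx => ?_⟩
  have hr : 0 < x ^ 2 / 8 := by positivity
  have hx_pow : (1 / (x ^ 2 / 8)) ^ b = 8 ^ b * x ^ (2 * -b) := by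
    rw [one_div_div, Real.div_rpow (by norm_num) (by positivity), Real.rpow_mul hx.le,
      Real.rpow_two, Real.rpow_neg (by positivity), div_eq_mul_inv]
  calc _ ≤ ∫ t in Ioi (0 : ℝ), K * (t ^ (-(b + 1)) * Real.exp (-(x ^ 2 / 8) / t)) := by
        refine integral_mono_of_nonneg ?_
          ((integrableOn_rpow_mul_exp_neg_div_Ioi hb hr).const_mul K) ?_
        · filter_upwards [ae_restrict_mem measurableSet_Ioi] with t ht
          have : Real.exp (-2 * t) ≤ 1 := Real.exp_le_one_iff.2 (by linarith [mem_Ioi.1 ht])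
          have := Real.rpow_nonneg (sub_nonneg.2 this) (-(b + 1))
          simp only [Pi.zero_apply]
          positivity
        · filter_upwards [ae_restrict_mem measurableSet_Ioi] with t ht
          have e : -x ^ 2 / (8 * t) = -(x ^ 2 / 8) / t := by
            rw [← neg_div, div_div]
          rw [e, mul_assoc]
          exact (mul_le_mul_of_nonneg_left (exp_mul_one_sub_exp_rpow_le hb ht)
            (Real.exp_pos _).le).trans_eq (by rw [← hK]; ring)
    _ = _ := by
        rw [integral_const_mul, integral_rpow_mul_exp_neg_div_Ioi hb hr, hx_pow]
        ring
end

section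
/- There is a constant C > 0 such that for all x, y with 0 < x/2 < y < 2x and x ≠ y, ∫_{R(x,y)} e^{-(x-y)²/(2t)} · e^{t/2} / (xy · √(1-e^{-t})) dt ≤ C / √(x·|x-y|). -/
open MeasureTheory Set

/-- The region `R(x,y) = { t > 0 : e^{-t}xy/(1-e^{-2t}) ≥ 1 }`. -/
def Rset (x y : ℝ) : Set ℝ :=
  {t : ℝ | 0 < t ∧ 1 ≤ Real.exp (-t) * x * y / (1 - Real.exp (-2*t))}

lemma Rset_subset_Ioc (x y : ℝ) : Rset x y ⊆ Ioc 0 (Real.log (x * y + 1)) := by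
  rintro t ⟨ht, h⟩
  refine ⟨ht, ?_⟩
  have hden : 0 < 1 - Real.exp (-2 * t) := by
    rw [sub_pos, Real.exp_lt_one_iff]
    linarith
  rw [le_div_iff₀ hden, one_mul] at h
  have hsq : Real.exp (-2 * t) = Real.exp (-t) * Real.exp (-t) := by
    rw [← Real.exp_add]
    ring_nf
  have hinv : Real.exp t * Real.exp (-t) = 1 := by
    rw [← Real.exp_add, add_neg_cancel, Real.exp_zero]
  have hle : Real.exp (-t) ≤ 1 := Real.exp_le_one_iff.2 (by linarith)
  have hmul := mul_le_mul_of_nonneg_left h (Real.exp_pos t).le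
  have hexp : Real.exp t ≤ x * y + 1 := by
    have h₁ : Real.exp t * (1 - Real.exp (-2 * t)) = Real.exp t - Real.exp (-t) := by
      rw [hsq]
      linear_combination (-Real.exp (-t)) * hinv
    have h₂ : Real.exp t * (Real.exp (-t) * x * y) = x * y := by
      linear_combination (x * y) * hinv
    linarith
  exact (Real.le_log_iff_exp_le ((Real.exp_pos t).trans_le hexp)).2 hexp

lemma exp_half_div_sqrt_one_sub_exp_neg (t : ℝ) :
    Real.exp (t / 2) / Real.sqrt (1 - Real.exp (-t)) =
      Real.exp t / Real.sqrt (Real.exp t - 1) := by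
  have hexp : Real.exp t = Real.exp (t / 2) * Real.exp (t / 2) := by
    rw [← Real.exp_add, add_halves]
  have hsub : Real.exp t - 1 = Real.exp (t / 2) ^ 2 * (1 - Real.exp (-t)) := by
    have hinv : Real.exp t * Real.exp (-t) = 1 := by
      rw [← Real.exp_add, add_neg_cancel, Real.exp_zero]
    rw [sq, ← hexp]
    linear_combination hinv
  rw [hsub, Real.sqrt_mul (sq_nonneg _), Real.sqrt_sq (Real.exp_pos _).le, hexp,
    mul_div_mul_left _ _ (Real.exp_pos _).ne']

lemma exp_neg_sq_div_mul_le (a t : ℝ) :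
    Real.exp (-a ^ 2 / (2 * t)) * (Real.exp t / Real.sqrt (Real.exp t - 1)) ≤
      Real.exp t / Real.sqrt (Real.exp t - 1) := by
  rcases le_or_gt t 0 with ht | ht
  · have h : Real.exp t - 1 ≤ 0 := sub_nonpos.2 (Real.exp_le_one_iff.2 ht)
    simp [Real.sqrt_eq_zero_of_nonpos h]
  · refine mul_le_of_le_one_left (by positivity) (Real.exp_le_one_iff.2 ?_)
    exact div_nonpos_of_nonpos_of_nonneg (neg_nonpos.2 (sq_nonneg a)) (by linarith)

lemma continuousOn_two_mul_sqrt_exp_sub_one (s : Set ℝ) :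
    ContinuousOn (fun t : ℝ => 2 * Real.sqrt (Real.exp t - 1)) s := by
  fun_prop

lemma hasDerivAt_two_mul_sqrt_exp_sub_one {t : ℝ} (ht : 0 < t) :
    HasDerivAt (fun t : ℝ => 2 * Real.sqrt (Real.exp t - 1))
      (Real.exp t / Real.sqrt (Real.exp t - 1)) t := by
  have hpos : 0 < Real.exp t - 1 := sub_pos.2 (Real.one_lt_exp_iff.2 ht)
  refine ((((Real.hasDerivAt_exp t).sub_const 1).sqrt hpos.ne').const_mul 2).congr_deriv ?_
  rw [← mul_div_assoc, mul_div_mul_left _ _ two_ne_zero]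

lemma integrableOn_exp_div_sqrt_exp_sub_one (T : ℝ) :
    IntegrableOn (fun t : ℝ => Real.exp t / Real.sqrt (Real.exp t - 1)) (Ioc 0 T) :=
  intervalIntegral.integrableOn_deriv_of_nonneg (continuousOn_two_mul_sqrt_exp_sub_one _)
    (fun _ ht => hasDerivAt_two_mul_sqrt_exp_sub_one ht.1) fun _ _ => by positivity

lemma setIntegral_exp_div_sqrt_exp_sub_one {T : ℝ} (hT : 0 ≤ T) :
    ∫ t in Ioc 0 T, Real.exp t / Real.sqrt (Real.exp t - 1) =
      2 * Real.sqrt (Real.exp T - 1) := by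
  rw [← intervalIntegral.integral_of_le hT,
    intervalIntegral.integral_eq_sub_of_hasDerivAt_of_le hT
      (continuousOn_two_mul_sqrt_exp_sub_one _)
      (fun _ ht => hasDerivAt_two_mul_sqrt_exp_sub_one ht.1)
      ((intervalIntegrable_iff_integrableOn_Ioc_of_le hT).2
        (integrableOn_exp_div_sqrt_exp_sub_one T))]
  simp

lemma setIntegral_Rset_le {x y : ℝ} (hxy : 0 < x * y) :
    (∫ t in Rset x y,
        Real.exp (-(x-y)^2 / (2*t)) * Real.exp (t/2) /
          (x * y * Real.sqrt (1 - Real.exp (-t)))) ≤ 2 / Real.sqrt (x * y) := by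
  set g : ℝ → ℝ := fun t => Real.exp t / Real.sqrt (Real.exp t - 1)
  have hg : IntegrableOn g (Ioc 0 (Real.log (x * y + 1))) :=
    integrableOn_exp_div_sqrt_exp_sub_one _
  have hfactor (t : ℝ) : Real.exp (-(x-y)^2 / (2*t)) * Real.exp (t/2) /
      (x * y * Real.sqrt (1 - Real.exp (-t))) =
        (x * y)⁻¹ * (Real.exp (-(x-y)^2 / (2*t)) * g t) := by
    simp only [g]
    rw [← exp_half_div_sqrt_one_sub_exp_neg, div_eq_mul_inv, mul_inv]
    ring
  simp only [hfactor]
  rw [integral_const_mul]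
  have hlog : 0 ≤ Real.log (x * y + 1) := Real.log_nonneg (by linarith)
  have hbound : ∫ t in Rset x y, Real.exp (-(x-y)^2 / (2*t)) * g t ≤
      2 * Real.sqrt (x * y) := calc
    _ ≤ ∫ t in Rset x y, g t :=
      integral_mono_of_nonneg (.of_forall fun t => by positivity)
        (hg.mono_set (Rset_subset_Ioc x y)) (.of_forall fun t => exp_neg_sq_div_mul_le _ t)
    _ ≤ ∫ t in Ioc 0 (Real.log (x * y + 1)), g t :=
      setIntegral_mono_set hg (.of_forall fun t => by positivity)
        (Rset_subset_Ioc x y).eventuallyLE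
    _ = 2 * Real.sqrt (x * y) := by
      rw [setIntegral_exp_div_sqrt_exp_sub_one hlog, Real.exp_log (by linarith),
        add_sub_cancel_right]
  calc _ ≤ (x * y)⁻¹ * (2 * Real.sqrt (x * y)) := by gcongr
    _ = 2 / Real.sqrt (x * y) := by
      rw [inv_mul_eq_div, mul_div_assoc, Real.sqrt_div_self, ← div_eq_mul_inv]

theorem laguerre_hermite_difference_region_estimate :
    ∃ C > (0:ℝ), ∀ x y : ℝ, 0 < x → x/2 < y → y < 2*x → x ≠ y →
      (∫ t in Rset x y,
        Real.exp (-(x-y)^2 / (2*t)) * Real.exp (t/2) /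
          (x * y * Real.sqrt (1 - Real.exp (-t)))) ≤
        C / Real.sqrt (x * |x - y|) := by
  refine ⟨4, by norm_num, fun x y hx hxy hyx hne => ?_⟩
  have hy : 0 < y := by linarith
  have habs : 0 < |x - y| := abs_pos.2 (sub_ne_zero.2 hne)
  have hlt : |x - y| ≤ x := abs_le.2 ⟨by linarith, by linarith⟩
  have hle : x * |x - y| ≤ 2 ^ 2 * (x * y) := by nlinarith
  have hsqrt : Real.sqrt (x * |x - y|) ≤ 2 * Real.sqrt (x * y) := by
    calc _ ≤ Real.sqrt (2 ^ 2 * (x * y)) := Real.sqrt_le_sqrt hle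
      _ = 2 * Real.sqrt (x * y) := by
        rw [Real.sqrt_mul (by norm_num), Real.sqrt_sq (by norm_num)]
  refine (setIntegral_Rset_le (mul_pos hx hy)).trans ?_
  rw [div_le_div_iff₀ (by positivity) (by positivity)]
  linarith
end
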